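/- For all real t, the integral over (0,∞) of (cos(tx) − 1)·(π/8)·csch(πx/2)·[(πx)²·coth³(πx/2) + coth(πx/2)·(5(πx)²·csch²(πx/2) + 4) − 6πx·coth²(πx/2) − 6πx·csch²(πx/2)] dx equals −t·tanh(t) − t²·(3 − 2t·tanh(t))·sech²(t). -/

import Mathlib

open Real MeasureTheory

lemma HasSum.congr_fun' {f g : ℕ → ℂ} {a b : ℂ} (h : ∀ n, f n = g n) (hab : a = b)
    (hg : HasSum g b) : HasSum f a := by
  rw [funext h, hab]; exact hg

lemma coth_series (t : ℝ) (ht : t ≠ 0) :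
    HasSum (fun n : ℕ => 2 * t / (t ^ 2 + ((n + 1) * π) ^ 2)) (cosh t / sinh t - 1 / t) := by
  have hπ : (π : ℂ) ≠ 0 := by exact_mod_cast Real.pi_ne_zero
  have htc : (t : ℂ) ≠ 0 := by exact_mod_cast ht
  set x : ℂ := t / π * Complex.I with hx
  have hxim : x.im = t / π := by
    have : x = ((t / π : ℝ) : ℂ) * Complex.I := by rw [hx]; push_cast; rfl
    rw [this, Complex.im_ofReal_mul, Complex.I_im, mul_one]
  have hz : x ∈ Complex.integerComplement := by
    rintro ⟨n, hn⟩
    have := congrArg Complex.im hn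
    rw [hxim] at this
    rw [Complex.intCast_im] at this
    exact (div_ne_zero ht Real.pi_ne_zero) this.symm
  have h1 := (summable_cotTerm hz).hasSum
  have h2 : ∑' n : ℕ, cotTerm x n = π * Complex.cot (π * x) - 1 / x := (cot_series_rep' hz).symm
  rw [h2] at h1
  have h3 := h1.mul_left (Complex.I / π)
  rw [← Complex.hasSum_ofReal]
  refine HasSum.congr_fun' ?_ ?_ h3
  · intro n
    have e1 : x - (n + 1) ≠ 0 := by
      intro h
      exact hz ⟨n + 1, by push_cast; linear_combination -h⟩
    have e2 : x + (n + 1) ≠ 0 := by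
      intro h
      exact hz ⟨-(n + 1), by push_cast; linear_combination -h⟩
    have e3 : ((t : ℂ) ^ 2 + ((n + 1) * π) ^ 2) ≠ 0 := by
      have : t ^ 2 + ((n + 1) * π) ^ 2 ≠ 0 := by positivity
      exact_mod_cast this
    unfold cotTerm
    push_cast
    rw [div_add_div _ _ e1 e2, div_mul_div_comm, div_eq_div_iff e3 (mul_ne_zero hπ (mul_ne_zero e1 e2)), hx]
    field_simp
    ring_nf
    simp only [Complex.I_sq]
    ring
  · have e : (π : ℂ) * x = t * Complex.I := by rw [hx]; field_simp
    rw [e, Complex.cot, Complex.cos_mul_I, Complex.sin_mul_I, hx]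
    have hs : Complex.sinh t ≠ 0 := by
      rw [← Complex.ofReal_sinh]; exact_mod_cast (Real.sinh_eq_zero.not.mpr ht)
    push_cast
    field_simp

lemma tanh_series (t : ℝ) :
    HasSum (fun n : ℕ => 2 * t / (t ^ 2 + ((2 * n + 1) * (π / 2)) ^ 2)) (tanh t) := by
  rcases eq_or_ne t 0 with rfl | ht
  · simp
  have h1 := coth_series t ht
  have h2 := (coth_series (2 * t) (by simpa using ht)).mul_left 2
  set f : ℕ → ℝ := fun n => 2 * (2 * (2 * t) / ((2 * t) ^ 2 + ((n + 1) * π) ^ 2)) with hf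
  have hodd : (fun n : ℕ => f (2 * n + 1)) =
      (fun n : ℕ => 2 * t / (t ^ 2 + ((n + 1) * π) ^ 2)) := by
    funext n
    simp only [hf]; push_cast
    have : t ^ 2 + ((n + 1) * π) ^ 2 ≠ 0 := by positivity
    have : (2 * t) ^ 2 + ((2 * (n:ℝ) + 1 + 1) * π) ^ 2 ≠ 0 := by positivity
    field_simp
    ring
  have heven : (fun n : ℕ => f (2 * n)) =
      (fun n : ℕ => 2 * t / (t ^ 2 + ((2 * n + 1) * (π / 2)) ^ 2)) := by
    funext n
    simp only [hf]; push_cast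
    have : t ^ 2 + ((2 * n + 1) * (π / 2)) ^ 2 ≠ 0 := by positivity
    have : (2 * t) ^ 2 + ((2 * (n:ℝ) + 1) * π) ^ 2 ≠ 0 := by positivity
    field_simp
  have hse : Summable (fun n : ℕ => f (2 * n)) :=
    h2.summable.comp_injective (mul_right_injective₀ (two_ne_zero))
  have h3 := hse.hasSum
  have h4 : HasSum (fun n : ℕ => f (2 * n + 1)) (cosh t / sinh t - 1 / t) := by rw [hodd]; exact h1
  have h5 := (h3.even_add_odd h4).unique h2
  rw [heven] at h3 h5
  convert h3 using 1
  have hs : sinh t ≠ 0 := Real.sinh_eq_zero.not.mpr ht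
  have hc : cosh t ≠ 0 := (Real.cosh_pos t).ne'
  have h6 := eq_sub_of_add_eq h5
  rw [h6, tanh_eq_sinh_div_cosh, sinh_two_mul, cosh_two_mul]
  field_simp
  ring

lemma S_le {u : ℝ} (hu : 0 < u) : u / sinh u ≤ (1 + 2 * u) * exp (-u) := by
  have hs : 0 < sinh u := sinh_pos_iff.mpr hu
  rw [div_le_iff₀ hs, sinh_eq]
  have h1 : exp (-u) * exp u = 1 := by rw [← exp_add]; simp
  have h2 : 2 * u + 1 ≤ exp (2 * u) := add_one_le_exp _
  have h3 : exp (-u) * exp (-u) * exp (2 * u) = 1 := by rw [← exp_add, ← exp_add]; ring_nf; simp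
  have h4 : 0 < exp (-u) * exp (-u) := by positivity
  have h5 : exp (-u) * exp (-u) * (2 * u + 1) ≤ 1 := by
    have := mul_le_mul_of_nonneg_left h2 h4.le
    rwa [h3] at this
  have : (1 + 2 * u) * exp (-u) * ((exp u - exp (-u)) / 2) =
    ((1 + 2 * u) * 1 - exp (-u) * exp (-u) * (2 * u + 1)) / 2 := by rw [← h1]; ring
  rw [this]; linarith

lemma S_nonneg {u : ℝ} (hu : 0 < u) : 0 ≤ u / sinh u :=
  div_nonneg hu.le (sinh_pos_iff.mpr hu).le

lemma S_le_one {u : ℝ} (hu : 0 < u) : u / sinh u ≤ 1 := by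
  rw [div_le_one (sinh_pos_iff.mpr hu)]; exact (self_le_sinh_iff.mpr hu.le)

lemma P_le {u : ℝ} (hu : 0 < u) : u / sinh u * cosh u ≤ 1 + 2 * u := by
  have hs : 0 < sinh u := sinh_pos_iff.mpr hu
  have h1 : cosh u ≤ sinh u + 1 := by
    have := cosh_sub_sinh u
    have h2 : exp (-u) ≤ 1 := exp_le_one_iff.mpr (by linarith)
    linarith
  have h2 := S_le_one hu
  have h3 := S_nonneg hu
  have h4 : u / sinh u * sinh u = u := by field_simp
  nlinarith

/-- The constant in the exponential bound. -/
noncomputable def KK : ℝ := 6144 * exp (1 / 4)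

lemma S_bound {u : ℝ} (hu : 0 < u) : u / sinh u * (1 + 2 * u) ^ 3 ≤ KK * exp (-(u / 2)) := by
  have h1 := S_le hu
  have h2 := pow_div_factorial_le_exp ((1 + 2 * u) / 4) (by positivity) 4
  have h3 : (1 + 2 * u) ^ 4 ≤ 6144 * exp ((1 + 2 * u) / 4) := by
    norm_num [Nat.factorial] at h2
    linarith
  calc u / sinh u * (1 + 2 * u) ^ 3 ≤ (1 + 2 * u) * exp (-u) * (1 + 2 * u) ^ 3 := by gcongr
    _ = (1 + 2 * u) ^ 4 * exp (-u) := by ring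
    _ ≤ 6144 * exp ((1 + 2 * u) / 4) * exp (-u) := by gcongr
    _ = KK * exp (-(u / 2)) := by
      unfold KK
      rw [mul_assoc, mul_assoc, ← exp_add, ← exp_add]; ring_nf

lemma intOn_of_bound {f : ℝ → ℝ} (hf : ContinuousOn f (Set.Ioi 0)) (C : ℝ)
    (h : ∀ u : ℝ, 0 < u → |f (2 * u / π)| ≤ C * (u / sinh u * (1 + 2 * u) ^ 3)) (hC : 0 ≤ C) :
    IntegrableOn f (Set.Ioi 0) := by
  have h1 : IntegrableOn (fun x : ℝ => C * KK * exp (-(π / 4) * x)) (Set.Ioi 0) :=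
    (exp_neg_integrableOn_Ioi 0 (by positivity)).const_mul _
  refine Integrable.mono' h1 (hf.aestronglyMeasurable measurableSet_Ioi) ?_
  filter_upwards [ae_restrict_mem measurableSet_Ioi] with x hx
  have hx : 0 < x := hx
  have hu : 0 < π * x / 2 := by positivity
  have h2 := h _ hu
  rw [show 2 * (π * x / 2) / π = x by field_simp] at h2
  calc ‖f x‖ ≤ _ := h2
    _ ≤ C * (KK * exp (-(π * x / 2 / 2))) := mul_le_mul_of_nonneg_left (S_bound hu) hC
    _ = _ := by rw [mul_assoc]; ring_nf

lemma sinh_ne {x : ℝ} (hx : x ∈ Set.Ioi (0:ℝ)) : sinh (π * x / 2) ≠ 0 := by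
  have hx : 0 < x := hx
  exact (sinh_pos_iff.mpr (by positivity)).ne'

lemma cont_g : ContinuousOn (fun x : ℝ => 1 / sinh (π * x / 2)) (Set.Ioi 0) := by
  refine ContinuousOn.div (by fun_prop) ?_ (fun x hx => sinh_ne hx)
  exact (Real.continuous_sinh.comp (by fun_prop)).continuousOn

lemma int1 : IntegrableOn (fun x : ℝ => x * (1 / sinh (π * x / 2))) (Set.Ioi 0) := by
  refine intOn_of_bound (continuousOn_id.mul cont_g) (2 / π) ?_ (by positivity)
  intro u hu
  rw [show π * (2 * u / π) / 2 = u by field_simp,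
    show 2 * u / π * (1 / sinh u) = 2 / π * (u / sinh u) by ring, abs_mul,
    abs_of_nonneg (S_nonneg hu), abs_of_pos (by positivity)]
  have := S_nonneg hu
  gcongr
  exact le_mul_of_one_le_right this (one_le_pow₀ (by linarith))

lemma int2 : IntegrableOn (fun x : ℝ => x ^ 2 * (1 / sinh (π * x / 2))) (Set.Ioi 0) := by
  refine intOn_of_bound ((continuousOn_id.pow 2).mul cont_g) ((2 / π) ^ 2) ?_ (by positivity)
  intro u hu
  rw [show π * (2 * u / π) / 2 = u by field_simp,
    show (2 * u / π) ^ 2 * (1 / sinh u) = (2 / π) ^ 2 * (u / sinh u * u) by ring, abs_mul,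
    abs_of_nonneg (mul_nonneg (S_nonneg hu) hu.le), abs_of_pos (by positivity)]
  have := S_nonneg hu
  gcongr
  nlinarith [mul_pos hu hu, mul_pos hu (mul_pos hu hu)]

lemma int_sin_exp (t a : ℝ) (ha : 0 < a) :
    ∫ x in Set.Ioi (0:ℝ), sin (t * x) * (2 * exp (-a * x)) = 2 * t / (t ^ 2 + a ^ 2) := by
  have hre : ((-a : ℝ) + t * Complex.I : ℂ).re < 0 := by simpa using ha
  have h := integral_exp_mul_complex_Ioi hre 0
  have hi := integrableOn_exp_mul_complex_Ioi hre 0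
  have h2 := congrArg Complex.im h
  rw [← Complex.imCLM_apply, ← ContinuousLinearMap.integral_comp_comm _ hi] at h2
  have e : ∀ x : ℝ, Complex.imCLM (Complex.exp (((-a : ℝ) + t * Complex.I) * x)) =
      exp (-a * x) * sin (t * x) := by
    intro x
    rw [Complex.imCLM_apply, Complex.exp_im]
    simp
  simp_rw [e] at h2
  have : ∀ x : ℝ, sin (t * x) * (2 * exp (-a * x)) = 2 * (exp (-a * x) * sin (t * x)) := by
    intro x; ring
  simp_rw [this]
  rw [integral_const_mul, h2]
  simp [Complex.div_im, Complex.normSq_apply]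
  have : t ^ 2 + a ^ 2 ≠ 0 := by positivity
  have : a * a + t * t ≠ 0 := by nlinarith [mul_pos ha ha, mul_self_nonneg t]
  field_simp
  ring

lemma congrHS {f g : ℕ → ℝ} {a b : ℝ} (h : ∀ n, f n = g n) (hab : a = b)
    (hg : HasSum g b) : HasSum f a := by
  rw [funext h, hab]; exact hg

lemma hasSum_g {x : ℝ} (hx : 0 < x) :
    HasSum (fun n : ℕ => 2 * exp (-((2 * n + 1) * (π / 2)) * x)) (1 / sinh (π * x / 2)) := by
  set u := π * x / 2 with hu
  have hu0 : 0 < u := by positivity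
  have h := (hasSum_geometric_of_lt_one (exp_pos (-(2 * u))).le
    (Real.exp_lt_one_iff.mpr (by linarith))).mul_left (2 * exp (-u))
  refine congrHS ?_ ?_ h
  · intro n
    rw [← exp_nat_mul, mul_assoc, ← exp_add, hu]; ring_nf
  · have hs : 0 < sinh u := sinh_pos_iff.mpr hu0
    have h1 : exp (-(2 * u)) < 1 := Real.exp_lt_one_iff.mpr (by linarith)
    have h2 : exp (-u) * exp u = 1 := by rw [← exp_add]; simp
    have h3 : exp (-(2 * u)) = exp (-u) * exp (-u) := by rw [← exp_add]; ring_nf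
    rw [← div_eq_mul_inv, div_eq_div_iff hs.ne' (by linarith), h3, sinh_eq]
    linear_combination -h2

lemma I0 (t : ℝ) : ∫ x in Set.Ioi (0:ℝ), sin (t * x) * (1 / sinh (π * x / 2)) = tanh t := by
  have key := hasSum_integral_of_dominated_convergence (μ := volume.restrict (Set.Ioi (0:ℝ)))
    (F := fun (n : ℕ) (x : ℝ) => sin (t * x) * (2 * exp (-((2 * n + 1) * (π / 2)) * x)))
    (f := fun x => sin (t * x) * (1 / sinh (π * x / 2)))
    (fun (n : ℕ) (x : ℝ) => |t| * x * (2 * exp (-((2 * n + 1) * (π / 2)) * x)))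
    (fun n => by
      apply Continuous.aestronglyMeasurable
      fun_prop)
    (fun n => by
      filter_upwards [ae_restrict_mem measurableSet_Ioi] with x hx
      have hx : 0 < x := hx
      rw [norm_mul, Real.norm_eq_abs, Real.norm_eq_abs, abs_of_pos (a := 2 * _) (by positivity)]
      gcongr
      refine abs_sin_le_abs.trans ?_
      rw [abs_mul, abs_of_pos hx])
    (by
      filter_upwards [ae_restrict_mem measurableSet_Ioi] with x hx
      exact (hasSum_g hx).summable.mul_left _)
    (by
      refine (int1.const_mul |t|).congr ?_
      filter_upwards [ae_restrict_mem measurableSet_Ioi] with x hx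
      rw [((hasSum_g hx).mul_left _).tsum_eq]; ring)
    (by
      filter_upwards [ae_restrict_mem measurableSet_Ioi] with x hx
      exact (hasSum_g hx).mul_left _)
  refine key.unique ?_
  have := tanh_series t
  exact congrHS (fun n => int_sin_exp t _ (by positivity)) rfl this

lemma I01 (t : ℝ) :
    IntegrableOn (fun x => x * cos (t * x) * (1 / sinh (π * x / 2))) (Set.Ioi 0) ∧
    HasDerivAt (fun t : ℝ => ∫ x in Set.Ioi (0:ℝ), sin (t * x) * (1 / sinh (π * x / 2)))
      (∫ x in Set.Ioi (0:ℝ), x * cos (t * x) * (1 / sinh (π * x / 2))) t := by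
  have hm (t : ℝ) : AEStronglyMeasurable (fun x => sin (t * x) * (1 / sinh (π * x / 2)))
      (volume.restrict (Set.Ioi (0:ℝ))) :=
    ContinuousOn.aestronglyMeasurable (ContinuousOn.mul (by fun_prop) cont_g) measurableSet_Ioi
  refine hasDerivAt_integral_of_dominated_loc_of_deriv_le (s := Set.univ) Filter.univ_mem
    (F' := fun t x => x * cos (t * x) * (1 / sinh (π * x / 2)))
    (Filter.Eventually.of_forall hm) ?_ ?_ ?_ int1 ?_
  · refine (int1.const_mul |t|).mono' (hm t) ?_
    filter_upwards [ae_restrict_mem measurableSet_Ioi] with x hx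
    have hx : 0 < x := hx
    have : 0 < sinh (π * x / 2) := sinh_pos_iff.mpr (by positivity)
    rw [norm_mul, Real.norm_eq_abs, Real.norm_eq_abs, abs_of_pos (a := 1 / _) (by positivity),
      ← mul_assoc]
    gcongr
    refine abs_sin_le_abs.trans ?_
    rw [abs_mul, abs_of_pos hx]
  · exact ContinuousOn.aestronglyMeasurable (ContinuousOn.mul (by fun_prop) cont_g)
      measurableSet_Ioi
  · filter_upwards [ae_restrict_mem measurableSet_Ioi] with x hx y _
    have hx : 0 < x := hx
    have : 0 < sinh (π * x / 2) := sinh_pos_iff.mpr (by positivity)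
    rw [norm_mul, Real.norm_eq_abs, Real.norm_eq_abs, abs_of_pos (a := 1 / _) (by positivity),
      abs_mul, abs_of_pos hx]
    gcongr
    exact mul_le_of_le_one_right hx.le (abs_cos_le_one _)
  · filter_upwards [ae_restrict_mem measurableSet_Ioi] with x hx y _
    have h : HasDerivAt (fun y => y * x) x y := by simpa using (hasDerivAt_id y).mul_const x
    exact (h.sin.mul_const (1 / sinh (π * x / 2))).congr_deriv (by ring)

lemma I12 (t : ℝ) :
    IntegrableOn (fun x => -(x ^ 2 * sin (t * x)) * (1 / sinh (π * x / 2))) (Set.Ioi 0) ∧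
    HasDerivAt (fun t : ℝ => ∫ x in Set.Ioi (0:ℝ), x * cos (t * x) * (1 / sinh (π * x / 2)))
      (∫ x in Set.Ioi (0:ℝ), -(x ^ 2 * sin (t * x)) * (1 / sinh (π * x / 2))) t := by
  have hm (t : ℝ) : AEStronglyMeasurable (fun x => x * cos (t * x) * (1 / sinh (π * x / 2)))
      (volume.restrict (Set.Ioi (0:ℝ))) :=
    ContinuousOn.aestronglyMeasurable (ContinuousOn.mul (by fun_prop) cont_g) measurableSet_Ioi
  refine hasDerivAt_integral_of_dominated_loc_of_deriv_le (s := Set.univ) Filter.univ_mem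
    (F' := fun t x => -(x ^ 2 * sin (t * x)) * (1 / sinh (π * x / 2)))
    (Filter.Eventually.of_forall hm) (I01 t).1 ?_ ?_ int2 ?_
  · exact ContinuousOn.aestronglyMeasurable (ContinuousOn.mul (by fun_prop) cont_g)
      measurableSet_Ioi
  · filter_upwards [ae_restrict_mem measurableSet_Ioi] with x hx y _
    have hx : 0 < x := hx
    have : 0 < sinh (π * x / 2) := sinh_pos_iff.mpr (by positivity)
    rw [norm_mul, Real.norm_eq_abs, Real.norm_eq_abs, abs_of_pos (a := 1 / _) (by positivity),
      abs_neg, abs_mul, abs_of_pos (by positivity : 0 < x ^ 2)]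
    gcongr
    exact mul_le_of_le_one_right (by positivity) (abs_sin_le_one _)
  · filter_upwards [ae_restrict_mem measurableSet_Ioi] with x hx y _
    have h : HasDerivAt (fun y => y * x) x y := by simpa using (hasDerivAt_id y).mul_const x
    exact ((h.cos.const_mul x).mul_const (1 / sinh (π * x / 2))).congr_deriv (by ring)

lemma hasDerivAt_tanh' (t : ℝ) : HasDerivAt tanh ((1 / cosh t) ^ 2) t := by
  have hc := (cosh_pos t).ne'
  have h := (hasDerivAt_sinh t).div (hasDerivAt_cosh t) hc
  have e : tanh = fun t => sinh t / cosh t := funext tanh_eq_sinh_div_cosh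
  rw [e]
  refine h.congr_deriv ?_
  have := cosh_sq t
  field_simp
  linarith

lemma I1 (t : ℝ) :
    ∫ x in Set.Ioi (0:ℝ), x * cos (t * x) * (1 / sinh (π * x / 2)) = (1 / cosh t) ^ 2 := by
  have h := (I01 t).2
  rw [funext I0] at h
  exact h.unique (hasDerivAt_tanh' t)

lemma I2 (t : ℝ) :
    ∫ x in Set.Ioi (0:ℝ), -(x ^ 2 * sin (t * x)) * (1 / sinh (π * x / 2)) =
      - (2 * tanh t * (1 / cosh t) ^ 2) := by
  have h := (I12 t).2
  rw [funext I1] at h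
  refine h.unique ?_
  have hc := (cosh_pos t).ne'
  have h2 := ((hasDerivAt_const t (1:ℝ)).div (hasDerivAt_cosh t) hc).pow 2
  refine h2.congr_deriv ?_
  rw [tanh_eq_sinh_div_cosh]
  simp
  field_simp

lemma int_sin (t : ℝ) :
    IntegrableOn (fun x => sin (t * x) * (1 / sinh (π * x / 2))) (Set.Ioi 0) := by
  refine (int1.const_mul |t|).mono'
    (ContinuousOn.aestronglyMeasurable (ContinuousOn.mul (by fun_prop) cont_g)
      measurableSet_Ioi) ?_
  filter_upwards [ae_restrict_mem measurableSet_Ioi] with x hx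
  have hx : 0 < x := hx
  have : 0 < sinh (π * x / 2) := sinh_pos_iff.mpr (by positivity)
  rw [norm_mul, Real.norm_eq_abs, Real.norm_eq_abs, abs_of_pos (a := 1 / _) (by positivity),
    ← mul_assoc]
  gcongr
  refine abs_sin_le_abs.trans ?_
  rw [abs_mul, abs_of_pos hx]

/-- The integrand. -/
noncomputable def LL (t x : ℝ) : ℝ :=
  (Real.cos (t * x) - 1) * (π / 8) * (1 / Real.sinh (π * x / 2)) *
        ((π * x) ^ 2 * (Real.cosh (π * x / 2) / Real.sinh (π * x / 2)) ^ 3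
          + (Real.cosh (π * x / 2) / Real.sinh (π * x / 2)) *
              (5 * (π * x) ^ 2 * (1 / Real.sinh (π * x / 2)) ^ 2 + 4)
          - 6 * π * x * (Real.cosh (π * x / 2) / Real.sinh (π * x / 2)) ^ 2
          - 6 * π * x * (1 / Real.sinh (π * x / 2)) ^ 2)

/-- The remainder after integrating by parts. -/
noncomputable def RR (t x : ℝ) : ℝ :=
  (-t) * (sin (t * x) * (1 / sinh (π * x / 2)))
    + (-3 * t ^ 2) * (x * cos (t * x) * (1 / sinh (π * x / 2)))
    + (- t ^ 3) * (-(x ^ 2 * sin (t * x)) * (1 / sinh (π * x / 2)))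

/-- The boundary term. -/
noncomputable def FF (t x : ℝ) : ℝ :=
  -(cos (t * x) - 1) * (-(π * x / 2 * cosh (π * x / 2) * (1 / sinh (π * x / 2)) ^ 2)
      + (π * x / 2) ^ 2 * (1 + cosh (π * x / 2) ^ 2) * (1 / sinh (π * x / 2)) ^ 3)
    + t * x * sin (t * x) * (π * x / 2 * cosh (π * x / 2) * (1 / sinh (π * x / 2)) ^ 2)
    + t * (x * sin (t * x) + t * x ^ 2 * cos (t * x)) * (1 / sinh (π * x / 2))

lemma FF_deriv (t x : ℝ) (hx : 0 < x) : HasDerivAt (FF t) (LL t x - RR t x) x := by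
  have hs : sinh (π * x / 2) ≠ 0 := sinh_ne hx
  have hu : HasDerivAt (fun x : ℝ => π * x / 2) (π / 2) x := by
    simpa using ((hasDerivAt_id x).const_mul π).div_const 2
  have hy : HasDerivAt (fun x : ℝ => t * x) t x := by
    simpa using (hasDerivAt_id x).const_mul t
  have hS := hy.sin
  have hC := hy.cos
  have hc := hu.cosh
  have hg := (hasDerivAt_const x (1:ℝ)).div hu.sinh hs
  have hX := hasDerivAt_id x
  have h1 := (hC.sub_const 1).neg.mul (((hu.mul hc).mul (hg.pow 2)).neg.add
    (((hu.pow 2).mul ((hc.pow 2).const_add 1)).mul (hg.pow 3)))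
  have h2 := ((hX.const_mul t).mul hS).mul ((hu.mul hc).mul (hg.pow 2))
  have h3 := (((hX.mul hS).add (((hX.pow 2).const_mul t).mul hC)).const_mul t).mul hg
  have h := (h1.add h2).add h3
  refine h.congr_deriv ?_
  have hcs := cosh_sq (π * x / 2)
  unfold LL RR
  simp only [Pi.mul_apply, Pi.add_apply, Pi.neg_apply, Pi.pow_apply, Pi.div_apply, id]
  generalize sin (t * x) = A at *
  generalize cos (t * x) = B at *
  generalize cosh (π * x / 2) = c at *
  generalize sinh (π * x / 2) = s at *
  have h2 : c ^ 2 = s ^ 2 + 1 := hcs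
  have h3 : c ^ 3 = c * (s ^ 2 + 1) := by rw [pow_succ, h2]; ring
  push_cast
  field_simp
  ring_nf
  simp only [h2, h3]
  ring

lemma LL_int (t : ℝ) : IntegrableOn (LL t) (Set.Ioi 0) := by
  have hcont : ContinuousOn (LL t) (Set.Ioi 0) := by
    have h1 := cont_g
    have h2 : ContinuousOn (fun x : ℝ => cosh (π * x / 2) / sinh (π * x / 2)) (Set.Ioi 0) := by
      refine ContinuousOn.div ?_ ?_ (fun x hx => sinh_ne hx)
      · exact (Real.continuous_cosh.comp (by fun_prop)).continuousOn
      · exact (Real.continuous_sinh.comp (by fun_prop)).continuousOn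
    unfold LL
    fun_prop
  refine intOn_of_bound hcont (13 * t ^ 2 / π) ?_ (by positivity)
  intro u hu
  have hs : 0 < sinh u := sinh_pos_iff.mpr hu
  have hw0 : 0 ≤ 1 - cos (t * (2 * u / π)) := by linarith [cos_le_one (t * (2 * u / π))]
  have hw1 : 1 - cos (t * (2 * u / π)) ≤ 2 * t ^ 2 / π ^ 2 * u ^ 2 := by
    have := one_sub_sq_div_two_le_cos (x := t * (2 * u / π))
    have e : (t * (2 * u / π)) ^ 2 / 2 = 2 * t ^ 2 / π ^ 2 * u ^ 2 := by field_simp; try ring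
    linarith
  have hS0 := S_nonneg hu
  have hS1 := S_le_one hu
  have hP1 := P_le hu
  have hP0 : 0 ≤ u / sinh u * cosh u := mul_nonneg hS0 (cosh_pos u).le
  set M := u ^ 2 * (cosh u / sinh u) ^ 3 + (cosh u / sinh u) * (5 * u ^ 2 * (1 / sinh u) ^ 2 + 1)
    - 3 * u * (cosh u / sinh u) ^ 2 - 3 * u * (1 / sinh u) ^ 2 with hM
  have e1 : LL t (2 * u / π) = -((1 - cos (t * (2 * u / π))) * (π / 2) * (1 / sinh u * M)) := by
    unfold LL
    rw [show π * (2 * u / π) / 2 = u by field_simp, show π * (2 * u / π) = 2 * u by field_simp,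
      show 6 * π * (2 * u / π) = 12 * u by field_simp; norm_num, hM]
    ring
  have e2 : u ^ 2 * (1 / sinh u * M) = u / sinh u * ((u / sinh u * cosh u) ^ 3
      + (u / sinh u * cosh u) * (5 * (u / sinh u) ^ 2 + 1) - 3 * (u / sinh u * cosh u) ^ 2
      - 3 * (u / sinh u) ^ 2) := by
    rw [hM]; field_simp
  rw [e1, abs_neg, abs_mul, abs_of_nonneg (by positivity)]
  calc (1 - cos (t * (2 * u / π))) * (π / 2) * |1 / sinh u * M|
      ≤ 2 * t ^ 2 / π ^ 2 * u ^ 2 * (π / 2) * |1 / sinh u * M| := by gcongr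
    _ = t ^ 2 / π * |u ^ 2 * (1 / sinh u * M)| := by
      rw [abs_mul (u ^ 2), abs_of_pos (by positivity : 0 < u ^ 2)]; field_simp
    _ ≤ t ^ 2 / π * (13 * (u / sinh u * (1 + 2 * u) ^ 3)) := by
      rw [e2, abs_mul, abs_of_nonneg hS0]
      have : |(u / sinh u * cosh u) ^ 3
        + (u / sinh u * cosh u) * (5 * (u / sinh u) ^ 2 + 1) - 3 * (u / sinh u * cosh u) ^ 2
        - 3 * (u / sinh u) ^ 2| ≤ 13 * (1 + 2 * u) ^ 3 := by
        generalize u / sinh u * cosh u = P at *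
        generalize u / sinh u = S at *
        have hv : 1 ≤ 1 + 2 * u := by linarith
        generalize 1 + 2 * u = v at *
        have a1 : P ^ 3 ≤ v ^ 3 := by gcongr
        have a2 : P ^ 2 ≤ v ^ 3 := by
          calc P ^ 2 ≤ v ^ 2 := by gcongr
            _ ≤ v ^ 3 := pow_le_pow_right₀ hv (by norm_num)
        have a3 : P ≤ v ^ 3 := by
          calc P ≤ v ^ 1 := by simpa using hP1
            _ ≤ v ^ 3 := pow_le_pow_right₀ hv (by norm_num)
        have a4 : S ^ 2 ≤ 1 := pow_le_one₀ hS0 hS1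
        have a5 : 1 ≤ v ^ 3 := one_le_pow₀ hv
        have a6 : P * S ^ 2 ≤ v ^ 3 := by nlinarith [sq_nonneg S]
        have b1 : 0 ≤ P ^ 3 := by positivity
        have b2 : 0 ≤ P ^ 2 := by positivity
        have b3 : 0 ≤ P * S ^ 2 := by positivity
        have b4 : 0 ≤ S ^ 2 := by positivity
        rw [abs_le]; constructor <;> nlinarith
      calc _ ≤ t ^ 2 / π * (u / sinh u * (13 * (1 + 2 * u) ^ 3)) := by gcongr
        _ = _ := by ring
    _ = _ := by ring

lemma R_tendsto : Filter.Tendsto (fun x : ℝ => x * (1 / sinh (π * x / 2)))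
    (nhdsWithin 0 (Set.Ioi 0)) (nhds (2 / π)) := by
  have hu : HasDerivAt (fun x : ℝ => π * x / 2) (π / 2) 0 := by
    simpa using ((hasDerivAt_id (0:ℝ)).const_mul π).div_const 2
  have h := hu.sinh
  rw [hasDerivAt_iff_tendsto_slope] at h
  have h2 := (h.mono_left (nhdsWithin_mono 0 (fun x (hx : 0 < x) => hx.ne'))).inv₀ (by simp)
  have e : (cosh (π * 0 / 2) * (π / 2))⁻¹ = 2 / π := by simp
  rw [e] at h2
  refine h2.congr ?_
  intro x
  simp [slope_def_field, div_eq_mul_inv, mul_comm]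

lemma FF_zero (t : ℝ) : Filter.Tendsto (FF t) (nhdsWithin 0 (Set.Ioi 0)) (nhds 0) := by
  have hR := R_tendsto
  have hB : Filter.Tendsto (fun x : ℝ => (cos (t * x) - 1) / x)
      (nhdsWithin 0 (Set.Ioi 0)) (nhds 0) := by
    have hy : HasDerivAt (fun x : ℝ => t * x) t 0 := by
      simpa using (hasDerivAt_id (0:ℝ)).const_mul t
    have h := hy.cos
    rw [hasDerivAt_iff_tendsto_slope] at h
    have h2 := (h.mono_left (nhdsWithin_mono 0 (fun x (hx : 0 < x) => hx.ne')))
    simp only [mul_zero, sin_zero, neg_zero, zero_mul] at h2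
    refine h2.congr ?_
    intro x
    simp [slope_def_field]
  have hc : Filter.Tendsto (fun x : ℝ => cosh (π * x / 2)) (nhdsWithin 0 (Set.Ioi 0))
      (nhds 1) := by
    have : Continuous (fun x : ℝ => cosh (π * x / 2)) := Real.continuous_cosh.comp (by fun_prop)
    simpa using (this.tendsto 0).mono_left nhdsWithin_le_nhds
  have hA : Filter.Tendsto (fun x : ℝ => sin (t * x)) (nhdsWithin 0 (Set.Ioi 0)) (nhds 0) := by
    have : Continuous (fun x : ℝ => sin (t * x)) := by fun_prop
    simpa using (this.tendsto 0).mono_left nhdsWithin_le_nhds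
  have hD : Filter.Tendsto (fun x : ℝ => sin (t * x) + t * x * cos (t * x))
      (nhdsWithin 0 (Set.Ioi 0)) (nhds 0) := by
    have : Continuous (fun x : ℝ => sin (t * x) + t * x * cos (t * x)) := by fun_prop
    simpa using (this.tendsto 0).mono_left nhdsWithin_le_nhds
  have h1 := hB.neg.mul (((hc.mul (hR.pow 2)).const_mul (-(π / 2))).add
    ((((hc.pow 2).const_add 1).mul (hR.pow 3)).const_mul ((π / 2) ^ 2)))
  have h2 := (hA.mul (hc.mul (hR.pow 2))).const_mul (t * (π / 2))
  have h3 := (hD.mul hR).const_mul t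
  have h := (h1.add h2).add h3
  simp only [neg_zero, zero_mul, mul_zero, add_zero] at h
  refine h.congr' ?_
  filter_upwards [self_mem_nhdsWithin] with x hx
  have hx : x ≠ 0 := (show 0 < x from hx).ne'
  unfold FF
  generalize 1 / sinh (π * x / 2) = g
  field_simp

lemma FF_top (t : ℝ) : Filter.Tendsto (FF t) Filter.atTop (nhds 0) := by
  have hlim : Filter.Tendsto (fun x : ℝ => (6 + 2 * |t| + t ^ 2) *
      (KK * exp (-(π * x / 2 / 2)))) Filter.atTop (nhds 0) := by
    have h1 : Filter.Tendsto (fun x : ℝ => π / 4 * x) Filter.atTop Filter.atTop :=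
      Filter.tendsto_id.const_mul_atTop (by positivity)
    have h2 := ((tendsto_exp_neg_atTop_nhds_zero.comp h1).const_mul KK).const_mul
      (6 + 2 * |t| + t ^ 2)
    simp only [mul_zero] at h2
    refine h2.congr (fun x => ?_)
    simp only [Function.comp]
    ring_nf
  refine squeeze_zero_norm' ?_ hlim
  filter_upwards [Filter.eventually_ge_atTop 1] with x hx1
  have hx : 0 < x := by linarith
  have hπ := Real.pi_gt_three
  have hu1 : 1 ≤ π * x / 2 := by nlinarith
  have hxu : x ≤ π * x / 2 := by nlinarith
  unfold FF
  generalize π * x / 2 = u at *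
  have hu : 0 < u := by linarith
  have hs : 0 < sinh u := sinh_pos_iff.mpr hu
  refine le_trans ?_ (mul_le_mul_of_nonneg_left (S_bound hu) (by positivity))
  have hS0 := S_nonneg hu
  have hS1 := S_le_one hu
  have hP1 := P_le hu
  have hP0 : 0 ≤ u / sinh u * cosh u := mul_nonneg hS0 (cosh_pos u).le
  have eS : u / sinh u = u * (1 / sinh u) := by ring
  have hg0 : 0 ≤ 1 / sinh u := by positivity
  have hc0 := (cosh_pos u).le
  rw [eS] at hS0 hS1 hP1 hP0 ⊢
  clear eS
  generalize 1 / sinh u = g at *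
  generalize cosh u = c at *
  have hA := abs_sin_le_one (t * x)
  have hB := abs_cos_le_one (t * x)
  generalize sin (t * x) = A at *
  generalize cos (t * x) = B at *
  have hv : 1 ≤ 1 + 2 * u := by linarith
  have hgS : g ≤ u * g := by nlinarith
  have huv : u ≤ 1 + 2 * u := by linarith
  have hxv := hxu.trans huv
  generalize 1 + 2 * u = v at *
  have hv0 : 0 ≤ v := by linarith
  have v1 : v ≤ v ^ 3 := le_self_pow₀ hv (by norm_num)
  have v2 : v ^ 2 ≤ v ^ 3 := pow_le_pow_right₀ hv (by norm_num)
  have v0 : 1 ≤ v ^ 3 := one_le_pow₀ hv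
  have b1 : u * c * g ^ 2 ≤ u * g * v ^ 3 := by
    calc u * c * g ^ 2 = g * (u * g * c) := by ring
      _ ≤ (u * g) * v := by gcongr
      _ ≤ _ := by gcongr
  have b2 : u ^ 2 * (1 + c ^ 2) * g ^ 3 ≤ 2 * (u * g * v ^ 3) := by
    calc u ^ 2 * (1 + c ^ 2) * g ^ 3 = g * (u * g) ^ 2 + g * (u * g * c) ^ 2 := by ring
      _ ≤ (u * g) * 1 ^ 2 + (u * g) * v ^ 2 := by gcongr
      _ ≤ (u * g) * v ^ 3 + (u * g) * v ^ 3 := by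
        gcongr
        simpa using v0
      _ = _ := by ring
  have b3 : x * (u * c * g ^ 2) ≤ u * g * v ^ 3 := by
    calc x * (u * c * g ^ 2) = (x * g) * (u * g * c) := by ring
      _ ≤ (u * g) * v := by gcongr
      _ ≤ _ := by gcongr
  have b4 : x * g ≤ u * g * v ^ 3 := by
    calc x * g ≤ u * g := by gcongr
      _ ≤ _ := le_mul_of_one_le_right hS0 v0
  have b5 : x ^ 2 * g ≤ u * g * v ^ 3 := by
    calc x ^ 2 * g = x * g * x := by ring
      _ ≤ u * g * v := by gcongr
      _ ≤ _ := by gcongr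
  have n1 : 0 ≤ u * c * g ^ 2 := by positivity
  have n2 : 0 ≤ u ^ 2 * (1 + c ^ 2) * g ^ 3 := by positivity
  have hB2 : |-(B - 1)| ≤ 2 := by
    rw [abs_le] at *; constructor <;> linarith
  set Q := u * g * v ^ 3 with hQ
  have hQ0 : 0 ≤ Q := by positivity
  have t1 : |-(B - 1) * (-(u * c * g ^ 2) + u ^ 2 * (1 + c ^ 2) * g ^ 3)| ≤ 2 * (3 * Q) := by
    rw [abs_mul]
    refine mul_le_mul hB2 ?_ (abs_nonneg _) (by norm_num)
    rw [abs_le]; constructor <;> linarith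
  have t2 : |t * x * A * (u * c * g ^ 2)| ≤ |t| * Q := by
    have : t * x * A * (u * c * g ^ 2) = t * (A * (x * (u * c * g ^ 2))) := by ring
    rw [this, abs_mul, abs_mul, abs_of_nonneg (by positivity : 0 ≤ x * (u * c * g ^ 2))]
    gcongr
    calc |A| * _ ≤ 1 * Q := by gcongr
      _ = Q := one_mul _
  have t3 : |t * (x * A + t * x ^ 2 * B) * g| ≤ |t| * Q + t ^ 2 * Q := by
    have : t * (x * A + t * x ^ 2 * B) * g = t * (A * (x * g)) + t ^ 2 * (B * (x ^ 2 * g)) := by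
      ring
    rw [this]
    refine (abs_add_le _ _).trans ?_
    rw [abs_mul t, abs_mul A, abs_mul (t ^ 2), abs_mul B, abs_of_nonneg (by positivity : 0 ≤ x * g),
      abs_of_nonneg (by positivity : 0 ≤ x ^ 2 * g), abs_of_nonneg (sq_nonneg t)]
    gcongr
    · calc |A| * _ ≤ 1 * Q := by gcongr
        _ = Q := one_mul _
    · calc |B| * _ ≤ 1 * Q := by gcongr
        _ = Q := one_mul _
  rw [Real.norm_eq_abs]
  refine (abs_add_le _ _).trans ?_
  have := abs_add_le (-(B - 1) * (-(u * c * g ^ 2) + u ^ 2 * (1 + c ^ 2) * g ^ 3))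
    (t * x * A * (u * c * g ^ 2))
  linarith

lemma main_LL (t : ℝ) : ∫ x in Set.Ioi (0:ℝ), LL t x =
    -t * Real.tanh t - t ^ 2 * (3 - 2 * t * Real.tanh t) * (1 / Real.cosh t) ^ 2 := by
  have i0 := (int_sin t).const_mul (-t)
  have i1 := (I01 t).1.const_mul (-3 * t ^ 2)
  have i2 := (I12 t).1.const_mul (- t ^ 3)
  have hRi : IntegrableOn (RR t) (Set.Ioi 0) := (i0.add i1).add i2
  have hR : ∫ x in Set.Ioi (0:ℝ), RR t x =
      -t * Real.tanh t - t ^ 2 * (3 - 2 * t * Real.tanh t) * (1 / Real.cosh t) ^ 2 := by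
    have : ∫ x in Set.Ioi (0:ℝ), RR t x = _ := integral_add (i0.add i1) i2
    rw [this]
    have : _ = _ := integral_add i0 i1
    rw [show (∫ a in Set.Ioi (0:ℝ), _) = _ from this, integral_const_mul, integral_const_mul, integral_const_mul, I0, I1, I2]
    ring
  have hF0 : FF t 0 = 0 := by simp [FF]
  have hcont : ContinuousWithinAt (FF t) (Set.Ici 0) 0 := by
    rw [← continuousWithinAt_Ioi_iff_Ici]
    have := FF_zero t
    unfold ContinuousWithinAt
    rwa [hF0]
  have h := integral_Ioi_of_hasDerivAt_of_tendsto hcont (fun x hx => FF_deriv t x hx)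
    ((LL_int t).sub hRi) (FF_top t)
  have h2 : ∫ x in Set.Ioi (0:ℝ), (LL t x - RR t x) = _ := integral_sub (LL_int t) hRi
  rw [h2, hF0, hR] at h
  linarith

theorem stmt_6 (t : ℝ) :
    ∫ x in Set.Ioi (0:ℝ),
      (Real.cos (t * x) - 1) * (π / 8) * (1 / Real.sinh (π * x / 2)) *
        ((π * x) ^ 2 * (Real.cosh (π * x / 2) / Real.sinh (π * x / 2)) ^ 3
          + (Real.cosh (π * x / 2) / Real.sinh (π * x / 2)) *
              (5 * (π * x) ^ 2 * (1 / Real.sinh (π * x / 2)) ^ 2 + 4)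
          - 6 * π * x * (Real.cosh (π * x / 2) / Real.sinh (π * x / 2)) ^ 2
          - 6 * π * x * (1 / Real.sinh (π * x / 2)) ^ 2)
    = -t * Real.tanh t - t ^ 2 * (3 - 2 * t * Real.tanh t) * (1 / Real.cosh t) ^ 2 := by
  exact main_LL t
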